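/- arXiv:2306.04895 — 2 statements merged into one kernel-verified Lean document; each statement's English description precedes it below -/
import Mathlib

section
/- Let μ and (μ_j)_{j∈ℕ} be probability measures on ℝᵐ × ℝⁿ, all with the same second marginal μ_Y, and suppose μ_j → μ weakly (i.e. ∫ ℓ dμ_j → ∫ ℓ dμ for every bounded continuous ℓ on ℝᵐ × ℝⁿ). Assume μ_Y has a bounded Lebesgue density p_Y and fix ŷ ∈ ℝⁿ with p_Y(ŷ) ≠ 0. Let κ and κ_j be Markov kernels from ℝⁿ to ℝᵐ disintegrating μ and μ_j respectively. Let q : ℝᵐ → ℝ be bounded and continuous, and set k(y) := ∫ q dκ(y) and k_j(y) := ∫ q dκ_j(y). Assume: (i) k is bounded and y ↦ k(y)p_Y(y) is continuous at ŷ; (ii) the family (k_j) is uniformly bounded and the family (y ↦ k_j(y)p_Y(y))_j is equicontinuous at ŷ. Then for every ε > 0 there exists Ñ ∈ ℕ such that |k(ŷ) − k_j(ŷ)| < ε for all j ≥ Ñ; that is, the conditional expectations k_j(ŷ) converge to the true conditional expectation k(ŷ). (Theorem 4.1 of the paper.) -/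
open MeasureTheory ProbabilityTheory Filter

open scoped Convolution in
/-- Averaging against a bump function centred at `x₀` reproduces `g x₀` up to the oscillation of
`g` on the support of the bump. -/
theorem ContDiffBump.abs_integral_normed_sub_mul_sub_le {G : Type*} [NormedAddCommGroup G]
    [NormedSpace ℝ G] [FiniteDimensional ℝ G] [MeasurableSpace G] [BorelSpace G]
    {ν : Measure G} [ν.IsAddHaarMeasure] (φ : ContDiffBump (0 : G)) {g : G → ℝ} {x₀ : G} {η : ℝ}
    (hg_meas : Measurable g) (hg : ∀ y, ‖y - x₀‖ < φ.rOut → |g y - g x₀| ≤ η) :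
    |∫ y, φ.normed ν (x₀ - y) * g y ∂ν - g x₀| ≤ η := by
  have h := φ.dist_normed_convolution_le (μ := ν) (x₀ := x₀) (ε := η)
    hg_meas.aestronglyMeasurable fun y hy => by
      rw [Real.dist_eq]
      exact hg y (by simpa [dist_eq_norm] using hy)
  simpa [convolution_eq_swap, Real.dist_eq] using h

/-- The integral of `q x * w y` against a measure with conditional kernel `κ` and second marginal
of density `p` is the Lebesgue integral of `w` times the conditional expectation of `q` times
`p`. -/
theorem integral_fst_mul_snd_eq_of_disintegration {X Y : Type*} [MeasurableSpace X]
    [MeasurableSpace Y] {ν : Measure Y} {μ : Measure (X × Y)} {κ : Kernel Y X} {p : Y → ℝ}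
    (hp_meas : Measurable p) (hp_nonneg : ∀ y, 0 ≤ p y)
    (hdensity : Measure.map Prod.snd μ = ν.withDensity (fun y => ENNReal.ofReal (p y)))
    (hκ : ∀ h : X × Y → ℝ, Measurable h → (∃ C : ℝ, ∀ z, |h z| ≤ C) →
      ∫ z, h z ∂μ = ∫ y, ∫ x, h (x, y) ∂(κ y) ∂(Measure.map Prod.snd μ))
    {q : X → ℝ} {w : Y → ℝ} (hq : Measurable q) (hw : Measurable w)
    (hbdd : ∃ C : ℝ, ∀ z : X × Y, |q z.1 * w z.2| ≤ C) :
    ∫ z, q z.1 * w z.2 ∂μ = ∫ y, w y * ((∫ x, q x ∂(κ y)) * p y) ∂ν := by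
  rw [hκ (fun z => q z.1 * w z.2) (by fun_prop) hbdd, hdensity,
    integral_withDensity_eq_integral_toReal_smul (by fun_prop) (by simp)]
  refine integral_congr_ae (.of_forall fun y => ?_)
  simp only [integral_mul_const, ENNReal.toReal_ofReal (hp_nonneg y), smul_eq_mul]
  ring

/-- Theorem 4.1 of the paper: convergence of the learned conditional expectations `k_j(ŷ)`
to the true conditional expectation `k(ŷ)` at a fixed measurement `ŷ` with `p_Y(ŷ) ≠ 0`,
given weak convergence of the joint measures `μ_j → μ`. -/
theorem conditional_expectation_convergence
    (m n : ℕ)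
    (μ : Measure (EuclideanSpace ℝ (Fin m) × EuclideanSpace ℝ (Fin n)))
    [IsProbabilityMeasure μ]
    (μs : ℕ → Measure (EuclideanSpace ℝ (Fin m) × EuclideanSpace ℝ (Fin n)))
    [∀ j, IsProbabilityMeasure (μs j)]
    -- all `μ_j` have the same second marginal as `μ`
    (hmarg : ∀ j, Measure.map Prod.snd (μs j) = Measure.map Prod.snd μ)
    -- weak convergence `μ_j → μ`
    (hweak : ∀ ℓ : EuclideanSpace ℝ (Fin m) × EuclideanSpace ℝ (Fin n) → ℝ,
      Continuous ℓ → (∃ C : ℝ, ∀ p, |ℓ p| ≤ C) →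
      Tendsto (fun j => ∫ p, ℓ p ∂(μs j)) atTop (nhds (∫ p, ℓ p ∂μ)))
    -- the common second marginal has a bounded Lebesgue density `p_Y`
    (pY : EuclideanSpace ℝ (Fin n) → ℝ) (hpY_meas : Measurable pY)
    (hpY_nonneg : ∀ y, 0 ≤ pY y) (hpY_bdd : ∃ C : ℝ, ∀ y, pY y ≤ C)
    (hdensity : Measure.map Prod.snd μ =
      volume.withDensity (fun y => ENNReal.ofReal (pY y)))
    (yhat : EuclideanSpace ℝ (Fin n)) (hyhat : pY yhat ≠ 0)
    -- Markov kernels disintegrating `μ` and the `μ_j`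
    (κ : Kernel (EuclideanSpace ℝ (Fin n)) (EuclideanSpace ℝ (Fin m)))
    [IsMarkovKernel κ]
    (hκ : ∀ h : EuclideanSpace ℝ (Fin m) × EuclideanSpace ℝ (Fin n) → ℝ,
      Measurable h → (∃ C : ℝ, ∀ p, |h p| ≤ C) →
      ∫ p, h p ∂μ = ∫ y, ∫ x, h (x, y) ∂(κ y) ∂(Measure.map Prod.snd μ))
    (κs : ℕ → Kernel (EuclideanSpace ℝ (Fin n)) (EuclideanSpace ℝ (Fin m)))
    [∀ j, IsMarkovKernel (κs j)]
    (hκs : ∀ j, ∀ h : EuclideanSpace ℝ (Fin m) × EuclideanSpace ℝ (Fin n) → ℝ,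
      Measurable h → (∃ C : ℝ, ∀ p, |h p| ≤ C) →
      ∫ p, h p ∂(μs j) = ∫ y, ∫ x, h (x, y) ∂(κs j y) ∂(Measure.map Prod.snd (μs j)))
    -- `q` bounded continuous, and the conditional expectations `k`, `k_j`
    (q : EuclideanSpace ℝ (Fin m) → ℝ) (hq_cont : Continuous q)
    (hq_bdd : ∃ C : ℝ, ∀ x, |q x| ≤ C)
    (k : EuclideanSpace ℝ (Fin n) → ℝ) (hk : ∀ y, k y = ∫ x, q x ∂(κ y))
    (ks : ℕ → EuclideanSpace ℝ (Fin n) → ℝ) (hks : ∀ j y, ks j y = ∫ x, q x ∂(κs j y))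
    -- (i) `k` bounded and `k·p_Y` continuous at `ŷ`
    (hk_bdd : ∃ C : ℝ, ∀ y, |k y| ≤ C)
    (hk_cont : ContinuousAt (fun y => k y * pY y) yhat)
    -- (ii) `(k_j)` uniformly bounded and `(k_j·p_Y)` equicontinuous at `ŷ`
    (hks_bdd : ∃ C : ℝ, ∀ j y, |ks j y| ≤ C)
    (hks_equi : ∀ ε > (0 : ℝ), ∃ δ > (0 : ℝ), ∀ j y, ‖y - yhat‖ < δ →
      |ks j y * pY y - ks j yhat * pY yhat| < ε) :
    ∀ ε > (0 : ℝ), ∃ N : ℕ, ∀ j ≥ N, |k yhat - ks j yhat| < ε := by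
  intro ε hε
  have hp : 0 < pY yhat := (hpY_nonneg yhat).lt_of_ne' hyhat
  obtain ⟨η, hη, hηε⟩ : ∃ η > 0, 3 * η = ε * pY yhat := ⟨ε * pY yhat / 3, by positivity, by ring⟩
  obtain ⟨δ₁, hδ₁, h₁⟩ := Metric.continuousAt_iff.1 hk_cont η hη
  obtain ⟨δ₂, hδ₂, h₂⟩ := hks_equi η hη
  let φ : ContDiffBump (0 : EuclideanSpace ℝ (Fin n)) :=
    ⟨min δ₁ δ₂ / 2, min δ₁ δ₂, by positivity, half_lt_self (by positivity)⟩
  let w : EuclideanSpace ℝ (Fin n) → ℝ := fun y => φ.normed volume (yhat - y)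
  have hw : Continuous w := by
    have := φ.continuous_normed (μ := volume)
    fun_prop
  have hbdd : ∃ C : ℝ, ∀ z : EuclideanSpace ℝ (Fin m) × EuclideanSpace ℝ (Fin n),
      |q z.1 * w z.2| ≤ C := by
    obtain ⟨A, hA⟩ := hq_bdd
    obtain ⟨B, hB⟩ := φ.continuous_normed (μ := volume) |>.bounded_above_of_compact_support
      φ.hasCompactSupport_normed
    refine ⟨A * B, fun z => ?_⟩
    rw [abs_mul]
    exact mul_le_mul (hA _) (hB _) (abs_nonneg _) ((abs_nonneg _).trans (hA z.1))
  have hk_meas : Measurable k := by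
    rw [funext hk]
    exact hq_cont.stronglyMeasurable.integral_kernel.measurable
  have hks_meas : ∀ j, Measurable (ks j) := fun j => by
    rw [funext (hks j)]
    exact hq_cont.stronglyMeasurable.integral_kernel.measurable
  have hlim : Tendsto (fun j => ∫ y, w y * (ks j y * pY y)) atTop
      (nhds (∫ y, w y * (k y * pY y))) := by
    have h := hweak (fun z => q z.1 * w z.2) (by fun_prop) hbdd
    rw [integral_fst_mul_snd_eq_of_disintegration hpY_meas hpY_nonneg hdensity hκ
      hq_cont.measurable hw.measurable hbdd] at h
    simp_rw [fun j => integral_fst_mul_snd_eq_of_disintegration hpY_meas hpY_nonneg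
      ((hmarg j).trans hdensity) (hκs j) hq_cont.measurable hw.measurable hbdd] at h
    simpa only [hk, hks] using h
  have hk_avg : |(∫ y, w y * (k y * pY y)) - k yhat * pY yhat| ≤ η :=
    φ.abs_integral_normed_sub_mul_sub_le (g := fun y => k y * pY y) (hk_meas.mul hpY_meas)
      fun y hy => (h₁ (by simpa [dist_eq_norm] using hy.trans_le (min_le_left _ _))).le
  have hks_avg : ∀ j, |(∫ y, w y * (ks j y * pY y)) - ks j yhat * pY yhat| ≤ η := fun j =>
    φ.abs_integral_normed_sub_mul_sub_le (g := fun y => ks j y * pY y)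
      ((hks_meas j).mul hpY_meas)
      fun y hy => (h₂ j y (hy.trans_le (min_le_right _ _))).le
  obtain ⟨N, hN⟩ := Metric.tendsto_atTop.1 hlim η hη
  refine ⟨N, fun j hj => lt_of_mul_lt_mul_right ?_ hp.le⟩
  have hNj := hN j hj
  have hj_avg := hks_avg j
  rw [Real.dist_eq, abs_lt] at hNj
  rw [abs_le] at hk_avg hj_avg
  have habs : |k yhat - ks j yhat| * pY yhat = |(k yhat - ks j yhat) * pY yhat| := by
    rw [abs_mul, abs_of_pos hp]
  rw [← hηε, habs, sub_mul, abs_lt]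
  constructor <;> linarith
end

section
/- Let μ and (μ_j)_{j∈ℕ} be probability measures on ℝᵐ × ℝⁿ, all with the same second marginal μ_Y, with μ_j → μ weakly. Assume μ_Y has a bounded Lebesgue density p_Y and fix ŷ ∈ ℝⁿ with p_Y(ŷ) ≠ 0. Let κ and κ_j be Markov kernels from ℝⁿ to ℝᵐ disintegrating μ and μ_j respectively. Let q : ℝᵐ → ℝ be bounded and continuous, and set k(y) := ∫ q dκ(y) and k_j(y) := ∫ q dκ_j(y). Assume: (i) k is bounded and y ↦ k(y)p_Y(y) is continuous at ŷ; (ii) the family (k_j) is uniformly bounded, the family (y ↦ k_j(y)p_Y(y))_j is equicontinuous at ŷ, and the family (k_j) itself is equicontinuous at ŷ. Then for every ε > 0 there exist σ̄ > 0 and N̄ ∈ ℕ such that for all j ≥ N̄, | k(ŷ) − ∫_{ℝⁿ} ( ∫_{ℝᵐ} q(x) dκ_j(y)(x) ) dN(ŷ, σ̄²I)(y) | < ε. In words: the conditional expectation of q under the true posterior at ŷ is approximated, to within ε, by the expectation of q under the measure obtained by sampling y from a Gaussian N(ŷ, σ̄²I) tightly centered at ŷ and then sampling x from the learned conditional κ_j(y).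 (Theorem 4.2 of the paper, the robustness result justifying noisy-measurement sampling.) -/
open MeasureTheory ProbabilityTheory Filter

/-- The Lebesgue density of the Gaussian measure `N(ŷ, σ²I)` on `ℝⁿ`:
`p_σ(y) = (2πσ²)^(−n/2) exp(−‖y−ŷ‖²/(2σ²))`. -/
noncomputable def gaussianPdf (n : ℕ) (yhat : EuclideanSpace ℝ (Fin n)) (σ : ℝ)
    (y : EuclideanSpace ℝ (Fin n)) : ℝ :=
  (2 * Real.pi * σ ^ 2) ^ (-(n : ℝ) / 2) * Real.exp (-‖y - yhat‖ ^ 2 / (2 * σ ^ 2))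

/-- The Gaussian probability measure `N(ŷ, σ²I)` on `ℝⁿ`, defined via its Lebesgue density. -/
noncomputable def gaussianMeasure (n : ℕ) (yhat : EuclideanSpace ℝ (Fin n)) (σ : ℝ) :
    Measure (EuclideanSpace ℝ (Fin n)) :=
  volume.withDensity (fun y => ENNReal.ofReal (gaussianPdf n yhat σ y))

/-- If `W` is a probability density, then `∫ W g` is within `∫ B` of the constant `c` as soon as
`B` dominates `W (g - c)`. -/
lemma abs_integral_mul_sub_le {α : Type*} [MeasurableSpace α] {ν : Measure α} {W g B : α → ℝ}
    {c : ℝ} (hW : Integrable W ν) (hW1 : ∫ y, W y ∂ν = 1)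
    (hWg : Integrable (fun y => W y * g y) ν) (hB : Integrable B ν)
    (h : ∀ y, |W y * (g y - c)| ≤ B y) :
    |(∫ y, W y * g y ∂ν) - c| ≤ ∫ y, B y ∂ν := by
  have hsub : ∫ y, W y * (g y - c) ∂ν = (∫ y, W y * g y ∂ν) - c := by
    simp_rw [mul_sub]
    rw [integral_sub hWg (hW.mul_const c), integral_mul_const, hW1, one_mul]
  rw [← hsub]
  exact norm_integral_le_of_norm_le (f := fun y => W y * (g y - c)) hB (Eventually.of_forall h)

/-- Averaging against a normalized bump function changes `g c` by at most the oscillation of `g`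
on the support of the bump. -/
lemma ContDiffBump.abs_integral_normed_mul_sub_le {n : ℕ} {c : EuclideanSpace ℝ (Fin n)}
    (f : ContDiffBump c) {g : EuclideanSpace ℝ (Fin n) → ℝ} {C η : ℝ}
    (hg : Measurable g) (hC : ∀ y, |g y| ≤ C) (h : ∀ y, ‖y - c‖ < f.rOut → |g y - g c| ≤ η) :
    |(∫ y, f.normed volume y * g y) - g c| ≤ η := by
  have hint : Integrable (f.normed volume) volume :=
    f.continuous_normed.integrable_of_hasCompactSupport f.hasCompactSupport_normed
  refine (abs_integral_mul_sub_le (B := fun y => f.normed volume y * η) hint f.integral_normed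
    (hint.mul_bdd hg.aestronglyMeasurable (Eventually.of_forall hC))
    (hint.mul_const η) fun y => ?_).trans_eq ?_
  · rw [abs_mul, abs_of_nonneg (f.nonneg_normed y)]
    by_cases hy : y ∈ Metric.ball c f.rOut
    · exact mul_le_mul_of_nonneg_left (h y (mem_ball_iff_norm.1 hy)) (f.nonneg_normed y)
    · rw [← f.support_normed_eq (μ := volume), Function.notMem_support] at hy
      simp [hy]
  · rw [integral_mul_const, f.integral_normed, one_mul]

/-- Integrating a product of functions of the two coordinates against a disintegrated measure
whose second marginal has density `p`. -/
lemma integral_fst_mul_snd_eq_of_disintegration_s6 {α β : Type*} [MeasurableSpace α]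
    [MeasurableSpace β] {ν : Measure (α × β)} {ρ : Measure β} {η : Kernel β α} {p : β → ℝ}
    (hp : Measurable p) (hp0 : ∀ y, 0 ≤ p y)
    (hmap : Measure.map Prod.snd ν = ρ.withDensity (fun y => ENNReal.ofReal (p y)))
    (hη : ∀ h : α × β → ℝ, Measurable h → (∃ C : ℝ, ∀ z, |h z| ≤ C) →
      ∫ z, h z ∂ν = ∫ y, ∫ x, h (x, y) ∂(η y) ∂(Measure.map Prod.snd ν))
    {q : α → ℝ} (hq : Measurable q) {Cq : ℝ} (hqC : ∀ x, |q x| ≤ Cq)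
    {φ : β → ℝ} (hφ : Measurable φ) {Cφ : ℝ} (hφC : ∀ y, |φ y| ≤ Cφ) :
    ∫ z, q z.1 * φ z.2 ∂ν = ∫ y, φ y * ((∫ x, q x ∂(η y)) * p y) ∂ρ := by
  rw [hη (fun z => q z.1 * φ z.2) ((hq.comp measurable_fst).mul (hφ.comp measurable_snd)) ⟨Cq * Cφ, fun z => ?_⟩, hmap,
    integral_withDensity_eq_integral_toReal_smul hp.ennreal_ofReal
      (Eventually.of_forall fun _ => ENNReal.ofReal_lt_top)]
  · refine integral_congr_ae (Eventually.of_forall fun y => ?_)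
    simp only [integral_mul_const, ENNReal.toReal_ofReal (hp0 y), smul_eq_mul]
    ring
  · rw [abs_mul]
    exact mul_le_mul (hqC _) (hφC _) (abs_nonneg _) ((abs_nonneg _).trans (hqC z.1))

lemma gaussianPdf_nonneg (n : ℕ) (c : EuclideanSpace ℝ (Fin n)) (σ : ℝ)
    (y : EuclideanSpace ℝ (Fin n)) : 0 ≤ gaussianPdf n c σ y := by
  unfold gaussianPdf
  positivity

lemma measurable_gaussianPdf (n : ℕ) (c : EuclideanSpace ℝ (Fin n)) (σ : ℝ) :
    Measurable (gaussianPdf n c σ) := by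
  unfold gaussianPdf
  fun_prop

lemma integral_gaussianPdf (n : ℕ) (c : EuclideanSpace ℝ (Fin n)) {σ : ℝ} (hσ : 0 < σ) :
    ∫ y, gaussianPdf n c σ y = 1 := by
  unfold gaussianPdf
  rw [integral_const_mul, integral_sub_right_eq_self
    (fun y : EuclideanSpace ℝ (Fin n) => Real.exp (-‖y‖ ^ 2 / (2 * σ ^ 2))) c]
  have hexp : ∀ y : EuclideanSpace ℝ (Fin n),
      -‖y‖ ^ 2 / (2 * σ ^ 2) = -(1 / (2 * σ ^ 2)) * ‖y‖ ^ 2 := fun y => by ring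
  simp_rw [hexp]
  rw [GaussianFourier.integral_rexp_neg_mul_sq_norm (by positivity), finrank_euclideanSpace,
    Fintype.card_fin, neg_div, Real.rpow_neg (by positivity)]
  have hbase : Real.pi / (1 / (2 * σ ^ 2)) = 2 * Real.pi * σ ^ 2 := by
    field_simp
  rw [hbase]
  exact inv_mul_cancel₀ (by positivity)

lemma integrable_gaussianPdf (n : ℕ) (c : EuclideanSpace ℝ (Fin n)) {σ : ℝ} (hσ : 0 < σ) :
    Integrable (gaussianPdf n c σ) volume :=
  Integrable.of_integral_ne_zero (by simp [integral_gaussianPdf n c hσ])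

lemma integral_gaussianMeasure (n : ℕ) (c : EuclideanSpace ℝ (Fin n)) (σ : ℝ)
    (g : EuclideanSpace ℝ (Fin n) → ℝ) :
    ∫ y, g y ∂(gaussianMeasure n c σ) = ∫ y, gaussianPdf n c σ y * g y := by
  unfold gaussianMeasure
  rw [integral_withDensity_eq_integral_toReal_smul (measurable_gaussianPdf n c σ).ennreal_ofReal
    (Eventually.of_forall fun _ => ENNReal.ofReal_lt_top)]
  simp [ENNReal.toReal_ofReal (gaussianPdf_nonneg n c σ _)]

/-- Away from its center, a Gaussian density is a small multiple of the Gaussian density with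
doubled variance. -/
lemma gaussianPdf_le_of_le_norm (n : ℕ) (c : EuclideanSpace ℝ (Fin n)) {σ δ : ℝ} (hσ : 0 < σ)
    (hδ : 0 ≤ δ) {y : EuclideanSpace ℝ (Fin n)} (hy : δ ≤ ‖y - c‖) :
    gaussianPdf n c σ y ≤ 2 ^ ((n : ℝ) / 2) * Real.exp (-δ ^ 2 / (4 * σ ^ 2)) *
      gaussianPdf n c (√2 * σ) y := by
  unfold gaussianPdf
  have hvar : 2 * Real.pi * (√2 * σ) ^ 2 = 2 * (2 * Real.pi * σ ^ 2) := by
    rw [mul_pow, Real.sq_sqrt zero_le_two]; ring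
  have hvar' : 2 * (√2 * σ) ^ 2 = 4 * σ ^ 2 := by
    rw [mul_pow, Real.sq_sqrt zero_le_two]; ring
  have htwo : (2 : ℝ) ^ ((n : ℝ) / 2) * 2 ^ (-(n : ℝ) / 2) = 1 := by
    rw [← Real.rpow_add two_pos, neg_div, add_neg_cancel, Real.rpow_zero]
  have hexp : Real.exp (-‖y - c‖ ^ 2 / (2 * σ ^ 2)) ≤
      Real.exp (-δ ^ 2 / (4 * σ ^ 2)) * Real.exp (-‖y - c‖ ^ 2 / (4 * σ ^ 2)) := by
    rw [← Real.exp_add, Real.exp_le_exp, ← add_div, div_le_div_iff₀ (by positivity) (by positivity)]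
    have hsq : δ ^ 2 ≤ ‖y - c‖ ^ 2 := by gcongr
    nlinarith [mul_nonneg (sub_nonneg.2 hsq) (sq_nonneg σ)]
  rw [hvar, hvar', Real.mul_rpow zero_le_two (by positivity)]
  calc _ ≤ (2 * Real.pi * σ ^ 2) ^ (-(n : ℝ) / 2) *
        (Real.exp (-δ ^ 2 / (4 * σ ^ 2)) * Real.exp (-‖y - c‖ ^ 2 / (4 * σ ^ 2))) := by gcongr
    _ = (2 ^ ((n : ℝ) / 2) * 2 ^ (-(n : ℝ) / 2)) * ((2 * Real.pi * σ ^ 2) ^ (-(n : ℝ) / 2) *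
        (Real.exp (-δ ^ 2 / (4 * σ ^ 2)) * Real.exp (-‖y - c‖ ^ 2 / (4 * σ ^ 2)))) := by
      rw [htwo, one_mul]
    _ = _ := by ring

/-- Bounded measurable functions that oscillate by at most `η` near `c` are moved by at most
`η` plus an explicit Gaussian tail when averaged against a Gaussian centered at `c`. -/
lemma abs_integral_gaussianMeasure_sub_le (n : ℕ) (c : EuclideanSpace ℝ (Fin n))
    {g : EuclideanSpace ℝ (Fin n) → ℝ} {C η δ σ : ℝ} (hσ : 0 < σ) (hδ : 0 ≤ δ) (hη : 0 ≤ η)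
    (hg : Measurable g) (hC : ∀ y, |g y| ≤ C) (h : ∀ y, ‖y - c‖ < δ → |g y - g c| ≤ η) :
    |(∫ y, g y ∂(gaussianMeasure n c σ)) - g c| ≤
      η + 2 * C * (2 ^ ((n : ℝ) / 2) * Real.exp (-δ ^ 2 / (4 * σ ^ 2))) := by
  have hσ' : 0 < √2 * σ := by positivity
  have hC0 : 0 ≤ C := (abs_nonneg _).trans (hC c)
  set t : ℝ := 2 ^ ((n : ℝ) / 2) * Real.exp (-δ ^ 2 / (4 * σ ^ 2)) with ht
  have ht0 : 0 ≤ t := by positivity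
  rw [integral_gaussianMeasure]
  have hi := integrable_gaussianPdf n c hσ
  have hi' := integrable_gaussianPdf n c hσ'
  refine (abs_integral_mul_sub_le
    (B := fun y => η * gaussianPdf n c σ y + 2 * C * t * gaussianPdf n c (√2 * σ) y) hi
    (integral_gaussianPdf n c hσ)
    (hi.mul_bdd hg.aestronglyMeasurable (Eventually.of_forall hC))
    ((hi.const_mul _).add (hi'.const_mul _)) fun y => ?_).trans_eq ?_
  · have h0 := gaussianPdf_nonneg n c σ y
    have h0' := gaussianPdf_nonneg n c (√2 * σ) y
    rw [abs_mul, abs_of_nonneg h0]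
    rcases lt_or_ge ‖y - c‖ δ with hy | hy
    · calc _ ≤ gaussianPdf n c σ y * η := mul_le_mul_of_nonneg_left (h y hy) h0
        _ ≤ _ := by rw [mul_comm]; exact le_add_of_nonneg_right (by positivity)
    · have hgy : |g y - g c| ≤ 2 * C := by
        linarith [abs_sub (g y) (g c), hC y, hC c]
      calc _ ≤ t * gaussianPdf n c (√2 * σ) y * (2 * C) :=
            mul_le_mul (gaussianPdf_le_of_le_norm n c hσ hδ hy) hgy (abs_nonneg _) (by positivity)
        _ = 2 * C * t * gaussianPdf n c (√2 * σ) y := by ring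
        _ ≤ _ := le_add_of_nonneg_left (by positivity)
  · rw [integral_add (hi.const_mul _) (hi'.const_mul _), integral_const_mul, integral_const_mul,
      integral_gaussianPdf n c hσ, integral_gaussianPdf n c hσ']
    ring

/-- The Gaussian tail factor is arbitrarily small for small standard deviation. -/
lemma exists_pos_mul_exp_neg_sq_div_lt (A : ℝ) {δ ε : ℝ} (hδ : 0 < δ) (hε : 0 < ε) :
    ∃ σ > (0 : ℝ), A * Real.exp (-δ ^ 2 / (4 * σ ^ 2)) < ε := by
  have hlim : Tendsto (fun s : ℝ => A * Real.exp (-(δ ^ 2 / 4 * s ^ 2))) atTop (nhds (A * 0)) :=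
    (Real.tendsto_exp_neg_atTop_nhds_zero.comp
      ((tendsto_pow_atTop two_ne_zero).const_mul_atTop (by positivity))).const_mul A
  rw [mul_zero] at hlim
  obtain ⟨s, hs, hs0⟩ := ((hlim.eventually_lt_const hε).and (eventually_gt_atTop 0)).exists
  refine ⟨s⁻¹, inv_pos.2 hs0, ?_⟩
  rwa [inv_pow, ← div_eq_mul_inv, div_div_eq_mul_div, neg_mul, neg_div, mul_div_right_comm]

/-- Theorem 4.2 of the paper: the robustness result justifying noisy-measurement sampling.
The true conditional expectation `k(ŷ)` is approximated, to within `ε`, by the expectation of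
`q` obtained by sampling `y ∼ N(ŷ, σ̄²I)` and then `x ∼ κ_j(y)`. -/
theorem conditional_expectation_noisy_sampling
    (m n : ℕ)
    (μ : Measure (EuclideanSpace ℝ (Fin m) × EuclideanSpace ℝ (Fin n)))
    [IsProbabilityMeasure μ]
    (μs : ℕ → Measure (EuclideanSpace ℝ (Fin m) × EuclideanSpace ℝ (Fin n)))
    [∀ j, IsProbabilityMeasure (μs j)]
    -- all `μ_j` have the same second marginal as `μ`
    (hmarg : ∀ j, Measure.map Prod.snd (μs j) = Measure.map Prod.snd μ)
    -- weak convergence `μ_j → μ`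
    (hweak : ∀ ℓ : EuclideanSpace ℝ (Fin m) × EuclideanSpace ℝ (Fin n) → ℝ,
      Continuous ℓ → (∃ C : ℝ, ∀ p, |ℓ p| ≤ C) →
      Tendsto (fun j => ∫ p, ℓ p ∂(μs j)) atTop (nhds (∫ p, ℓ p ∂μ)))
    -- the common second marginal has a bounded Lebesgue density `p_Y`
    (pY : EuclideanSpace ℝ (Fin n) → ℝ) (hpY_meas : Measurable pY)
    (hpY_nonneg : ∀ y, 0 ≤ pY y) (hpY_bdd : ∃ C : ℝ, ∀ y, pY y ≤ C)
    (hdensity : Measure.map Prod.snd μ =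
      volume.withDensity (fun y => ENNReal.ofReal (pY y)))
    (yhat : EuclideanSpace ℝ (Fin n)) (hyhat : pY yhat ≠ 0)
    -- Markov kernels disintegrating `μ` and the `μ_j`
    (κ : Kernel (EuclideanSpace ℝ (Fin n)) (EuclideanSpace ℝ (Fin m)))
    [IsMarkovKernel κ]
    (hκ : ∀ h : EuclideanSpace ℝ (Fin m) × EuclideanSpace ℝ (Fin n) → ℝ,
      Measurable h → (∃ C : ℝ, ∀ p, |h p| ≤ C) →
      ∫ p, h p ∂μ = ∫ y, ∫ x, h (x, y) ∂(κ y) ∂(Measure.map Prod.snd μ))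
    (κs : ℕ → Kernel (EuclideanSpace ℝ (Fin n)) (EuclideanSpace ℝ (Fin m)))
    [∀ j, IsMarkovKernel (κs j)]
    (hκs : ∀ j, ∀ h : EuclideanSpace ℝ (Fin m) × EuclideanSpace ℝ (Fin n) → ℝ,
      Measurable h → (∃ C : ℝ, ∀ p, |h p| ≤ C) →
      ∫ p, h p ∂(μs j) = ∫ y, ∫ x, h (x, y) ∂(κs j y) ∂(Measure.map Prod.snd (μs j)))
    -- `q` bounded continuous, and the conditional expectations `k`, `k_j`
    (q : EuclideanSpace ℝ (Fin m) → ℝ) (hq_cont : Continuous q)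
    (hq_bdd : ∃ C : ℝ, ∀ x, |q x| ≤ C)
    (k : EuclideanSpace ℝ (Fin n) → ℝ) (hk : ∀ y, k y = ∫ x, q x ∂(κ y))
    (ks : ℕ → EuclideanSpace ℝ (Fin n) → ℝ) (hks : ∀ j y, ks j y = ∫ x, q x ∂(κs j y))
    -- (i) `k` bounded and `k·p_Y` continuous at `ŷ`
    (hk_bdd : ∃ C : ℝ, ∀ y, |k y| ≤ C)
    (hk_cont : ContinuousAt (fun y => k y * pY y) yhat)
    -- (ii) `(k_j)` uniformly bounded, `(k_j·p_Y)` equicontinuous at `ŷ`, and `(k_j)` itself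
    -- equicontinuous at `ŷ`
    (hks_bdd : ∃ C : ℝ, ∀ j y, |ks j y| ≤ C)
    (hks_pY_equi : ∀ ε > (0 : ℝ), ∃ δ > (0 : ℝ), ∀ j y, ‖y - yhat‖ < δ →
      |ks j y * pY y - ks j yhat * pY yhat| < ε)
    (hks_equi : ∀ ε > (0 : ℝ), ∃ δ > (0 : ℝ), ∀ j y, ‖y - yhat‖ < δ →
      |ks j y - ks j yhat| < ε) :
    ∀ ε > (0 : ℝ), ∃ σbar > (0 : ℝ), ∃ N : ℕ, ∀ j ≥ N,
      |k yhat - ∫ y, (∫ x, q x ∂(κs j y)) ∂(gaussianMeasure n yhat σbar)| < ε := by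
  obtain ⟨Cq, hCq⟩ := hq_bdd
  obtain ⟨Cp, hCp⟩ := hpY_bdd
  obtain ⟨Ck, hCk⟩ := hk_bdd
  obtain ⟨C, hC⟩ := hks_bdd
  have hk_meas : Measurable k := by
    rw [funext hk]
    exact hq_cont.stronglyMeasurable.integral_kernel.measurable
  have hks_meas : ∀ j, Measurable (ks j) := fun j => by
    rw [funext (hks j)]
    exact hq_cont.stronglyMeasurable.integral_kernel.measurable
  have hmul_bdd : ∀ {a b D : ℝ}, |a| ≤ D → 0 ≤ b → b ≤ Cp → |a * b| ≤ D * Cp :=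
    fun {a b D} ha hb hbC => by
      rw [abs_mul, abs_of_nonneg hb]
      exact mul_le_mul ha hbC hb ((abs_nonneg _).trans ha)
  -- pointwise convergence of the joint densities integrated against `q`
  have hlim_mul : Tendsto (fun j => ks j yhat * pY yhat) atTop (nhds (k yhat * pY yhat)) := by
    rw [Metric.tendsto_atTop]
    intro ε hε
    obtain ⟨δ₁, hδ₁, h₁⟩ := Metric.continuousAt_iff.1 hk_cont (ε / 4) (by positivity)
    obtain ⟨δ₂, hδ₂, h₂⟩ := hks_pY_equi (ε / 4) (by positivity)
    have hδ : 0 < min δ₁ δ₂ := lt_min hδ₁ hδ₂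
    let f : ContDiffBump yhat := ⟨min δ₁ δ₂ / 2, min δ₁ δ₂, half_pos hδ, half_lt_self hδ⟩
    set φ := f.normed volume
    have hφ : Continuous φ := f.continuous_normed
    obtain ⟨Cφ, hCφ⟩ := f.hasCompactSupport_normed.exists_bound_of_continuous hφ
    have hconv := hweak (fun p => q p.1 * φ p.2)
      ((hq_cont.comp continuous_fst).mul (hφ.comp continuous_snd))
      ⟨Cq * Cφ, fun p => by
        rw [abs_mul]
        exact mul_le_mul (hCq _) (hCφ _) (abs_nonneg _) ((abs_nonneg _).trans (hCq p.1))⟩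
    simp_rw [integral_fst_mul_snd_eq_of_disintegration_s6 hpY_meas hpY_nonneg hdensity hκ
        hq_cont.measurable hCq hφ.measurable hCφ,
      fun j => integral_fst_mul_snd_eq_of_disintegration_s6 hpY_meas hpY_nonneg
        ((hmarg j).trans hdensity) (hκs j) hq_cont.measurable hCq hφ.measurable hCφ,
      ← hk, ← hks] at hconv
    obtain ⟨N, hN⟩ := Metric.tendsto_atTop.1 hconv (ε / 4) (by positivity)
    refine ⟨N, fun j hj => ?_⟩
    have hk_avg : |(∫ y, φ y * (k y * pY y)) - k yhat * pY yhat| ≤ ε / 4 :=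
      f.abs_integral_normed_mul_sub_le (g := fun y => k y * pY y) (hk_meas.mul hpY_meas)
        (fun y => hmul_bdd (hCk y) (hpY_nonneg y) (hCp y))
        fun y hy => (h₁ (by simpa [dist_eq_norm] using hy.trans_le (min_le_left _ _))).le
    have hks_avg : |(∫ y, φ y * (ks j y * pY y)) - ks j yhat * pY yhat| ≤ ε / 4 :=
      f.abs_integral_normed_mul_sub_le (g := fun y => ks j y * pY y) ((hks_meas j).mul hpY_meas)
        (fun y => hmul_bdd (hC j y) (hpY_nonneg y) (hCp y))
        fun y hy => (h₂ j y (hy.trans_le (min_le_right _ _))).le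
    have hj' := hN j hj
    rw [Real.dist_eq, abs_lt] at hj' ⊢
    rw [abs_le] at hk_avg hks_avg
    constructor <;> linarith [hj'.1, hj'.2, hk_avg.1, hk_avg.2, hks_avg.1, hks_avg.2]
  have hlim : Tendsto (fun j => ks j yhat) atTop (nhds (k yhat)) := by
    simpa [hyhat] using hlim_mul.div_const (pY yhat)
  intro ε hε
  obtain ⟨δ, hδ, hosc⟩ := hks_equi (ε / 4) (by positivity)
  obtain ⟨σ, hσ, htail⟩ := exists_pos_mul_exp_neg_sq_div_lt (2 * C * 2 ^ ((n : ℝ) / 2)) hδ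
    (show 0 < ε / 4 by positivity)
  obtain ⟨N, hN⟩ := Metric.tendsto_atTop.1 hlim (ε / 4) (by positivity)
  refine ⟨σ, hσ, N, fun j hj => ?_⟩
  have hgauss := abs_integral_gaussianMeasure_sub_le n yhat hσ hδ.le
    (show 0 ≤ ε / 4 by positivity) (hks_meas j) (hC j) fun y hy => (hosc j y hy).le
  have hj' := hN j hj
  simp_rw [← hks]
  rw [← mul_assoc] at hgauss
  rw [Real.dist_eq, abs_lt] at hj'
  rw [abs_le] at hgauss
  rw [abs_lt]
  constructor <;> linarith [hj'.1, hj'.2, hgauss.1, hgauss.2]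
end
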